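/- arXiv:1601.05190 — 2 statements merged into one kernel-verified Lean document; each statement's English description precedes it below -/
import Mathlib

section
/- Let G be a finite simple undirected connected graph on n ≥ 1 vertices. Then G is regular if and only if its σ-sequence is symmetric, i.e., if and only if σ(i) + σ(n−i+1) = σ(1) + σ(n) for every i ∈ {1, …, n}. -/
variable {V : Type*} [Fintype V] [DecidableEq V]

/-- `eCount G S` is the number of edges of `G` with both endpoints in `S`. -/
def eCount (G : SimpleGraph V) [DecidableRel G.Adj] (S : Finset V) : ℕ :=
  (G.edgeFinset.filter fun e => ∀ v ∈ e, v ∈ S).card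

/-- `vcCount G S` is the number of edges of `G` with at least one endpoint in `S`. -/
def vcCount (G : SimpleGraph V) [DecidableRel G.Adj] (S : Finset V) : ℕ :=
  (G.edgeFinset.filter fun e => ∃ v ∈ e, v ∈ S).card

/-- `cCount G S` is the number of edges of `G` with exactly one endpoint in `S`. -/
def cCount (G : SimpleGraph V) [DecidableRel G.Adj] (S : Finset V) : ℕ :=
  (G.edgeFinset.filter fun e => (∃ v ∈ e, v ∈ S) ∧ ∃ v ∈ e, v ∉ S).card

/-- Maximum of `f S` over all vertex subsets `S` of cardinality `i`. -/
noncomputable def maxOver (f : Finset V → ℕ) (i : ℕ) : ℕ :=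
  sSup {k | ∃ S : Finset V, S.card = i ∧ f S = k}

/-- Minimum of `f S` over all vertex subsets `S` of cardinality `i`. -/
noncomputable def minOver (f : Finset V → ℕ) (i : ℕ) : ℕ :=
  sInf {k | ∃ S : Finset V, S.card = i ∧ f S = k}

/-- `Δ(i)`: maximum number of edges induced by `i` vertices. -/
noncomputable def DeltaMax (G : SimpleGraph V) [DecidableRel G.Adj] (i : ℕ) : ℕ :=
  maxOver (eCount G) i

/-- `Σ(i)`: minimum number of edges induced by `i` vertices. -/
noncomputable def SigmaMin (G : SimpleGraph V) [DecidableRel G.Adj] (i : ℕ) : ℕ :=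
  minOver (eCount G) i

/-- `T(i)`: maximum number of edges touched by `i` vertices. -/
noncomputable def Tmax (G : SimpleGraph V) [DecidableRel G.Adj] (i : ℕ) : ℕ :=
  maxOver (vcCount G) i

/-- `Υ(i)`: minimum number of edges touched by `i` vertices. -/
noncomputable def UpsilonMin (G : SimpleGraph V) [DecidableRel G.Adj] (i : ℕ) : ℕ :=
  minOver (vcCount G) i

/-- `Θ(i)`: maximum number of edges cut by an `(i, n-i)` bipartition. -/
noncomputable def ThetaMax (G : SimpleGraph V) [DecidableRel G.Adj] (i : ℕ) : ℕ :=
  maxOver (cCount G) i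

/-- `Φ(i)`: minimum number of edges cut by an `(i, n-i)` bipartition. -/
noncomputable def PhiMin (G : SimpleGraph V) [DecidableRel G.Adj] (i : ℕ) : ℕ :=
  minOver (cCount G) i

/-- `δ(i) = Δ(i) - Δ(i-1)` as an integer. -/
noncomputable def deltaSeq (G : SimpleGraph V) [DecidableRel G.Adj] (i : ℕ) : ℤ :=
  (DeltaMax G i : ℤ) - (DeltaMax G (i - 1) : ℤ)

/-- `σ(i) = Σ(i) - Σ(i-1)` as an integer. -/
noncomputable def sigmaSeq (G : SimpleGraph V) [DecidableRel G.Adj] (i : ℕ) : ℤ :=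
  (SigmaMin G i : ℤ) - (SigmaMin G (i - 1) : ℤ)

/-- `τ(i) = T(i) - T(i-1)` as an integer. -/
noncomputable def tauSeq (G : SimpleGraph V) [DecidableRel G.Adj] (i : ℕ) : ℤ :=
  (Tmax G i : ℤ) - (Tmax G (i - 1) : ℤ)

/-- `υ(i) = Υ(i) - Υ(i-1)` as an integer. -/
noncomputable def upsilonSeq (G : SimpleGraph V) [DecidableRel G.Adj] (i : ℕ) : ℤ :=
  (UpsilonMin G i : ℤ) - (UpsilonMin G (i - 1) : ℤ)

/-- `θ(i) = Θ(i) - Θ(i-1)` as an integer. -/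
noncomputable def thetaSeq (G : SimpleGraph V) [DecidableRel G.Adj] (i : ℕ) : ℤ :=
  (ThetaMax G i : ℤ) - (ThetaMax G (i - 1) : ℤ)

/-- `φ(i) = Φ(i) - Φ(i-1)` as an integer. -/
noncomputable def phiSeq (G : SimpleGraph V) [DecidableRel G.Adj] (i : ℕ) : ℤ :=
  (PhiMin G i : ℤ) - (PhiMin G (i - 1) : ℤ)

theorem minOver_le {α : Type*} (f : Finset α → ℕ) (S : Finset α) : minOver f S.card ≤ f S :=
  Nat.sInf_le ⟨S, rfl, rfl⟩

theorem exists_eq_minOver {α : Type*} [Fintype α] (f : Finset α → ℕ)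
    {i : ℕ} (hi : i ≤ Fintype.card α) :
    ∃ S : Finset α, S.card = i ∧ f S = minOver f i := by
  obtain ⟨S, -, hS⟩ := Finset.exists_subset_card_eq (s := (Finset.univ : Finset α)) hi
  exact Nat.sInf_mem (s := {k | ∃ S : Finset α, S.card = i ∧ f S = k}) ⟨f S, S, hS, rfl⟩

theorem eCount_univ (G : SimpleGraph V) [DecidableRel G.Adj] :
    eCount G Finset.univ = G.edgeFinset.card := by
  simp [eCount]

theorem eCount_empty (G : SimpleGraph V) [DecidableRel G.Adj] : eCount G ∅ = 0 := by
  rw [eCount, Finset.card_eq_zero, Finset.filter_eq_empty_iff]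
  intro e _
  induction e with | _ a b => exact fun h => Finset.notMem_empty a (h a (Sym2.mem_mk_left a b))

theorem eCount_singleton (G : SimpleGraph V) [DecidableRel G.Adj] (v : V) :
    eCount G {v} = 0 := by
  rw [eCount, Finset.card_eq_zero, Finset.filter_eq_empty_iff]
  intro e he
  induction e with | _ a b =>
  have hab : a ≠ b := (SimpleGraph.mem_edgeFinset.1 he : G.Adj a b).ne
  simp only [Sym2.mem_iff, Finset.mem_singleton, forall_eq_or_imp, forall_eq]
  rintro ⟨rfl, rfl⟩
  exact hab rfl

theorem eCount_compl_add_sum_degree (G : SimpleGraph V) [DecidableRel G.Adj] (T : Finset V) :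
    eCount G Tᶜ + ∑ v ∈ T, G.degree v = G.edgeFinset.card + eCount G T := by
  have hdeg : ∑ v ∈ T, G.degree v = ∑ e ∈ G.edgeFinset, (T.filter (· ∈ e)).card := by
    simp_rw [← G.card_incidenceFinset_eq_degree, G.incidenceFinset_eq_filter]
    exact Finset.sum_card_bipartiteAbove_eq_sum_card_bipartiteBelow (fun v (e : Sym2 V) => v ∈ e)
  rw [hdeg, eCount, eCount, Finset.card_filter, Finset.card_filter,
    Finset.card_eq_sum_ones G.edgeFinset, ← Finset.sum_add_distrib, ← Finset.sum_add_distrib]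
  refine Finset.sum_congr rfl fun e he => ?_
  induction e with | _ a b =>
  have hab : a ≠ b := (SimpleGraph.mem_edgeFinset.1 he : G.Adj a b).ne
  have hmem : T.filter (· ∈ s(a, b)) = T ∩ {a, b} := by
    ext v; simp
  rw [hmem]
  by_cases ha : a ∈ T <;> by_cases hb : b ∈ T <;>
    simp [ha, hb, hab, Finset.inter_insert_of_mem, Finset.inter_insert_of_notMem]

theorem SigmaMin_zero (G : SimpleGraph V) [DecidableRel G.Adj] : SigmaMin G 0 = 0 := by
  have h := minOver_le (eCount G) ∅
  rw [eCount_empty, Finset.card_empty] at h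
  exact Nat.le_zero.1 h

theorem SigmaMin_one (G : SimpleGraph V) [DecidableRel G.Adj] [Nonempty V] :
    SigmaMin G 1 = 0 := by
  have h := minOver_le (eCount G) {Classical.arbitrary V}
  rw [eCount_singleton, Finset.card_singleton] at h
  exact Nat.le_zero.1 h

theorem SigmaMin_card (G : SimpleGraph V) [DecidableRel G.Adj] :
    SigmaMin G (Fintype.card V) = G.edgeFinset.card := by
  obtain ⟨S, hS, h⟩ := exists_eq_minOver (eCount G) le_rfl
  rw [SigmaMin, ← h, (Finset.card_eq_iff_eq_univ S).1 hS, eCount_univ]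

theorem degree_le_sigmaSeq_card (G : SimpleGraph V) [DecidableRel G.Adj] (v : V) :
    (G.degree v : ℤ) ≤ sigmaSeq G (Fintype.card V) := by
  have h := minOver_le (eCount G) {v}ᶜ
  rw [Finset.card_compl, Finset.card_singleton] at h
  have h' := eCount_compl_add_sum_degree G {v}
  rw [Finset.sum_singleton, eCount_singleton] at h'
  rw [sigmaSeq, SigmaMin_card, SigmaMin]
  omega

theorem sum_sigmaSeq (G : SimpleGraph V) [DecidableRel G.Adj] :
    ∑ i ∈ Finset.range (Fintype.card V), sigmaSeq G (i + 1) = G.edgeFinset.card := by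
  simp only [sigmaSeq, Nat.add_sub_cancel]
  rw [Finset.sum_range_sub (fun i => (SigmaMin G i : ℤ)), SigmaMin_card, SigmaMin_zero]
  simp

theorem SigmaMin_card_sub_of_isRegularOfDegree {G : SimpleGraph V} [DecidableRel G.Adj] {d : ℕ}
    (hG : G.IsRegularOfDegree d) {i : ℕ} (hi : i ≤ Fintype.card V) :
    SigmaMin G (Fintype.card V - i) + i * d = G.edgeFinset.card + SigmaMin G i := by
  have key (T : Finset V) :
      eCount G Tᶜ + T.card * d = G.edgeFinset.card + eCount G T := by
    simpa [hG.degree_eq] using eCount_compl_add_sum_degree G T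
  apply le_antisymm
  · obtain ⟨T, rfl, hT⟩ := exists_eq_minOver (eCount G) hi
    have h := minOver_le (eCount G) Tᶜ
    rw [Finset.card_compl] at h
    rw [SigmaMin, SigmaMin, ← hT, ← key]
    omega
  · obtain ⟨S, hS, h⟩ := exists_eq_minOver (eCount G) (Nat.sub_le (Fintype.card V) i)
    have hc : Sᶜ.card = i := by rw [Finset.card_compl]; omega
    have h' := minOver_le (eCount G) Sᶜ
    have hk := key Sᶜ
    rw [compl_compl, hc] at hk
    rw [hc] at h'
    rw [SigmaMin, SigmaMin, ← h, hk]
    omega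

theorem sigmaSeq_add_sigmaSeq_of_isRegularOfDegree {G : SimpleGraph V} [DecidableRel G.Adj]
    {d : ℕ} (hG : G.IsRegularOfDegree d) {i : ℕ} (hi : 1 ≤ i) (hin : i ≤ Fintype.card V) :
    sigmaSeq G i + sigmaSeq G (Fintype.card V - i + 1) = d := by
  obtain ⟨j, rfl⟩ := Nat.exists_eq_add_of_le' hi
  have h₁ := SigmaMin_card_sub_of_isRegularOfDegree hG hin
  have h₂ := SigmaMin_card_sub_of_isRegularOfDegree hG (i := j) (by omega)
  have hj : Fintype.card V - (j + 1) + 1 = Fintype.card V - j := by omega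
  rw [sigmaSeq, sigmaSeq, Nat.add_sub_cancel, Nat.add_sub_cancel, hj]
  zify at h₁ h₂
  linarith

theorem regular_iff_sigmaSeq_symmetric (G : SimpleGraph V) [DecidableRel G.Adj]
    (hconn : G.Connected) (hn : 1 ≤ Fintype.card V) :
    (∃ d, G.IsRegularOfDegree d) ↔
      ∀ i ∈ Finset.Icc 1 (Fintype.card V),
        sigmaSeq G i + sigmaSeq G (Fintype.card V - i + 1) =
          sigmaSeq G 1 + sigmaSeq G (Fintype.card V) := by
  have : Nonempty V := Fintype.card_pos_iff.1 hn
  constructor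
  · rintro ⟨d, hG⟩ i hi
    obtain ⟨h₁, h₂⟩ := Finset.mem_Icc.1 hi
    have h := sigmaSeq_add_sigmaSeq_of_isRegularOfDegree hG le_rfl hn
    rw [Nat.sub_add_cancel hn] at h
    rw [sigmaSeq_add_sigmaSeq_of_isRegularOfDegree hG h₁ h₂, h]
  · intro h
    have hone : sigmaSeq G 1 = 0 := by simp [sigmaSeq, SigmaMin_one, SigmaMin_zero]
    have hrefl : ∑ i ∈ Finset.range (Fintype.card V), sigmaSeq G (Fintype.card V - (i + 1) + 1) =
        G.edgeFinset.card := by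
      rw [← sum_sigmaSeq, ← Finset.sum_range_reflect (fun i => sigmaSeq G (i + 1))]
      refine Finset.sum_congr rfl fun i _ => ?_
      rw [Nat.sub_sub, add_comm 1 i]
    have hsum : ∑ v, (G.degree v : ℤ) = ∑ _v : V, sigmaSeq G (Fintype.card V) := by
      have hpair : ∑ i ∈ Finset.range (Fintype.card V),
          (sigmaSeq G (i + 1) + sigmaSeq G (Fintype.card V - (i + 1) + 1)) =
          ∑ _i ∈ Finset.range (Fintype.card V), sigmaSeq G (Fintype.card V) := by
        refine Finset.sum_congr rfl fun i hi => ?_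
        have hi' := Finset.mem_range.1 hi
        rw [h (i + 1) (Finset.mem_Icc.2 ⟨by omega, by omega⟩), hone, zero_add]
      rw [Finset.sum_add_distrib, sum_sigmaSeq, hrefl, Finset.sum_const, Finset.card_range] at hpair
      rw [Finset.sum_const, Finset.card_univ, ← hpair, ← Nat.cast_sum,
        G.sum_degrees_eq_twice_card_edges]
      push_cast
      ring
    have hdeg := (Finset.sum_eq_sum_iff_of_le fun v _ => degree_le_sigmaSeq_card G v).1 hsum
    refine ⟨(sigmaSeq G (Fintype.card V)).toNat, fun v => ?_⟩
    rw [← hdeg v (Finset.mem_univ v), Int.toNat_natCast]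
end

section
/- Let G be a finite simple undirected graph on n ≥ 1 vertices with m edges, and let d be the minimum degree of G. If δ(i) + δ(n−i+1) = d for every i ∈ {1, …, n}, then 2m = n·d and G is d-regular. -/
variable {V : Type*} [Fintype V] [DecidableEq V]

theorem maxOver_zero {α : Type*} (f : Finset α → ℕ) : maxOver f 0 = f ∅ := by
  simp [maxOver, Finset.card_eq_zero]

theorem maxOver_card {α : Type*} [Fintype α] (f : Finset α → ℕ) :
    maxOver f (Fintype.card α) = f Finset.univ := by
  simp [maxOver, Finset.card_eq_iff_eq_univ]

theorem DeltaMax_zero (G : SimpleGraph V) [DecidableRel G.Adj] : DeltaMax G 0 = 0 := by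
  rw [DeltaMax, maxOver_zero, eCount_empty]

theorem DeltaMax_card (G : SimpleGraph V) [DecidableRel G.Adj] :
    DeltaMax G (Fintype.card V) = G.edgeFinset.card := by
  rw [DeltaMax, maxOver_card, eCount_univ]

theorem sum_deltaSeq (G : SimpleGraph V) [DecidableRel G.Adj] :
    ∑ i ∈ Finset.range (Fintype.card V), deltaSeq G (i + 1) = G.edgeFinset.card := by
  simp only [deltaSeq, Nat.add_sub_cancel]
  rw [Finset.sum_range_sub (fun i => (DeltaMax G i : ℤ)), DeltaMax_zero, DeltaMax_card]
  simp

/-- A graph whose number of edges is the least one compatible with its minimum degree is regular. -/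
theorem isRegularOfDegree_minDegree {α : Type*} [Fintype α] (G : SimpleGraph α)
    [DecidableRel G.Adj]
    (h : 2 * G.edgeFinset.card = Fintype.card α * G.minDegree) :
    G.IsRegularOfDegree G.minDegree := by
  have hsum : ∑ v : α, G.minDegree = ∑ v, G.degree v := by
    rw [G.sum_degrees_eq_twice_card_edges, h]
    simp
  intro v
  exact ((Finset.sum_eq_sum_iff_of_le fun v _ => G.minDegree_le_degree v).1 hsum v
    (Finset.mem_univ v)).symm

theorem regular_of_symmetric_deltaSeq (G : SimpleGraph V) [DecidableRel G.Adj]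
    (hn : 1 ≤ Fintype.card V)
    (hsym : ∀ i ∈ Finset.Icc 1 (Fintype.card V),
      deltaSeq G i + deltaSeq G (Fintype.card V - i + 1) = (G.minDegree : ℤ)) :
    2 * G.edgeFinset.card = Fintype.card V * G.minDegree ∧
      G.IsRegularOfDegree G.minDegree := by
  have hreflect : ∑ i ∈ Finset.range (Fintype.card V), deltaSeq G (Fintype.card V - 1 - i + 1) =
      G.edgeFinset.card := by
    rw [Finset.sum_range_reflect (fun i => deltaSeq G (i + 1)), sum_deltaSeq]
  have hedges : 2 * G.edgeFinset.card = Fintype.card V * G.minDegree := by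
    zify
    rw [two_mul]
    nth_rewrite 1 [← sum_deltaSeq]
    rw [← hreflect, ← Finset.sum_add_distrib, Finset.sum_congr rfl (g := fun _ => (G.minDegree : ℤ))]
    · simp
    · intro i hi
      have hi := Finset.mem_range.1 hi
      rw [← hsym (i + 1) (Finset.mem_Icc.2 ⟨by omega, by omega⟩), Nat.sub_sub, Nat.add_comm 1 i]
  exact ⟨hedges, isRegularOfDegree_minDegree G hedges⟩
end
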